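/- Let (X,d) be a compact metric space, f : X → X continuous with h_top(f) < +∞, and φ, ψ ∈ C(X,ℝ) with ψ > 0. Then: (i) the set t_{ψ,φ}(X,f) of tangent functionals of P_ψ(·) at φ is a compact convex set; (ii) M_{ψ,φ}(X,f) ⊆ t_{ψ,φ}(X,f) ⊆ M(X,f); (iii) a Borel probability measure μ belongs to t_{ψ,φ}(X,f) if and only if P_ψ(φ) − (∫φ dμ)/(∫ψ dμ) = inf{P_ψ(h) − (∫h dμ)/(∫ψ dμ) : h ∈ C(X,ℝ)}. -/

import Mathlib

open Filter Set Topology MeasureTheory ENNReal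

variable {X : Type*}

/-- Birkhoff sum `S_n φ = ∑_{i<n} φ ∘ f^i`. -/
def birkhoff (f : X → X) (φ : X → ℝ) (n : ℕ) (x : X) : ℝ :=
  ∑ i ∈ Finset.range n, φ (f^[i] x)

section Metric
variable [MetricSpace X]

/-- `F` is an `(n,ε)`-spanning set of `Z`: every `y ∈ Z` is within Bowen distance
`d_n ≤ ε` of some point of `F`. -/
def IsSpanningSetOf (f : X → X) (n : ℕ) (ε : ℝ) (Z : Set X) (F : Finset X) : Prop :=
  ∀ y ∈ Z, ∃ x ∈ F, ∀ i < n, dist (f^[i] x) (f^[i] y) ≤ ε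

/-- `E` is an `(n,ε)`-separated set of `Z`: `E ⊆ Z` and distinct points of `E` are at
Bowen distance `d_n > ε`. -/
def IsSeparatedSetOf (f : X → X) (n : ℕ) (ε : ℝ) (Z : Set X) (E : Finset X) : Prop :=
  (E : Set X) ⊆ Z ∧ ∀ x ∈ E, ∀ y ∈ E, x ≠ y → ∃ i < n, ε < dist (f^[i] x) (f^[i] y)

/-- `S_T = {n : ℕ | ∃ x, S_nψ(x) ≤ T < S_{n+1}ψ(x)}`. -/
def inducedST (f : X → X) (ψ : X → ℝ) (T : ℝ) : Set ℕ :=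
  {n | ∃ x : X, birkhoff f ψ n x ≤ T ∧ T < birkhoff f ψ (n + 1) x}

/-- `X_n = {x | S_nψ(x) ≤ T < S_{n+1}ψ(x)}`. -/
def inducedXn (f : X → X) (ψ : X → ℝ) (T : ℝ) (n : ℕ) : Set X :=
  {x | birkhoff f ψ n x ≤ T ∧ T < birkhoff f ψ (n + 1) x}

/-- `Q_{ψ,T}(f,φ,ε)`: infimum over families of `(n,ε)`-spanning sets of the `X_n`, `n ∈ S_T`,
of `∑_{n ∈ S_T} ∑_{x ∈ F_n} e^{S_nφ(x)}`. -/
noncomputable def inducedQ (f : X → X) (ψ φ : X → ℝ) (T ε : ℝ) : ℝ≥0∞ :=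
  ⨅ (F : ℕ → Finset X) (_ : ∀ n ∈ inducedST f ψ T,
      IsSpanningSetOf f n ε (inducedXn f ψ T n) (F n)),
    ∑' n : inducedST f ψ T, ∑ x ∈ F n, ENNReal.ofReal (Real.exp (birkhoff f φ n x))

/-- `P_{ψ,T}(f,φ,ε)`: supremum over families of `(n,ε)`-separated sets of the `X_n`, `n ∈ S_T`,
of `∑_{n ∈ S_T} ∑_{x ∈ E_n} e^{S_nφ(x)}`. -/
noncomputable def inducedPsep (f : X → X) (ψ φ : X → ℝ) (T ε : ℝ) : ℝ≥0∞ :=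
  ⨆ (E : ℕ → Finset X) (_ : ∀ n ∈ inducedST f ψ T,
      IsSeparatedSetOf f n ε (inducedXn f ψ T n) (E n)),
    ∑' n : inducedST f ψ T, ∑ x ∈ E n, ENNReal.ofReal (Real.exp (birkhoff f φ n x))

/-- The ψ-induced topological pressure
`P_ψ(φ) = lim_{ε→0⁺} limsup_{T→∞} (1/T) log Q_{ψ,T}(f,φ,ε)`, the limit as `ε → 0⁺`
being realized as a `limsup` along `𝓝[>] 0` (since `ε ↦ limsup_T …` is monotone,
this coincides with the limit). -/
noncomputable def inducedPressure (f : X → X) (ψ φ : X → ℝ) : EReal :=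
  limsup (fun ε : ℝ =>
    limsup (fun T : ℝ => ENNReal.log (inducedQ f ψ φ T ε) * ((T⁻¹ : ℝ) : EReal)) atTop)
    (𝓝[>] (0 : ℝ))

/-- Topological entropy `h_top(f) = P_ψ(0)` with `ψ ≡ 1`. -/
noncomputable def topEntropy (f : X → X) : EReal :=
  inducedPressure f (fun _ => 1) (fun _ => 0)

end Metric
section Meas
variable [MetricSpace X] [MeasurableSpace X] [BorelSpace X]

/-- Entropy of the finite measurable partition of `X` induced by a map `q` into a finite
type: `H(q) = ∑_s -μ(q⁻¹{s}) log μ(q⁻¹{s})`. -/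
noncomputable def mapEntropy {S : Type*} [Fintype S] (μ : Measure X) (q : X → S) : ℝ :=
  ∑ s : S, Real.negMulLog ((μ (q ⁻¹' {s})).toReal)

/-- Kolmogorov–Sinai (measure-theoretic) entropy `h_μ(f)`: the supremum, over finite
measurable partitions (encoded as measurable maps `p : X → Fin k`), of
`lim_n (1/n) H(⋁_{i<n} f^{-i} p)`; the limit exists by subadditivity and is
realized here as a `liminf`. -/
noncomputable def measEntropy (f : X → X) (μ : Measure X) : EReal :=
  ⨆ (k : ℕ) (p : X → Fin k) (_ : Measurable p),
    liminf (fun n : ℕ =>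
      (((n : ℝ)⁻¹ * mapEntropy μ (fun x (i : Fin n) => p (f^[i] x)) : ℝ) : EReal)) atTop

/-- The set `M(X,f)` of `f`-invariant Borel probability measures on `X`. -/
def invMeasures (f : X → X) : Set (Measure X) :=
  {μ | IsProbabilityMeasure μ ∧ ∀ B : Set X, MeasurableSet B → μ (f ⁻¹' B) = μ B}

/-- `μ` is an equilibrium state of `P_ψ(φ)`:
`μ ∈ M(X,f)` and `P_ψ(φ) = (h_μ(f) + ∫φ dμ)/(∫ψ dμ)`. -/
noncomputable def equilibriumStates (f : X → X) (ψ φ : X → ℝ) : Set (Measure X) :=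
  {μ | μ ∈ invMeasures f ∧
    inducedPressure f ψ φ =
      (measEntropy f μ + ((∫ x, φ x ∂μ : ℝ) : EReal)) / (((∫ x, ψ x ∂μ : ℝ) : EReal))}

end Meas

section Tangent
variable [MetricSpace X] [MeasurableSpace X] [BorelSpace X]

/-- The set `t_{ψ,φ}(X,f)` of tangent functionals (subdifferentials) of `P_ψ(·)` at `φ`:
Borel probability measures `μ` with `P_ψ(φ+g) − P_ψ(φ) ≥ (∫g dμ)/(∫ψ dμ)` for all
continuous `g`. -/
noncomputable def tangentSet (f : X → X) (ψ φ : X → ℝ) : Set (ProbabilityMeasure X) :=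
  {μ | ∀ g : X → ℝ, Continuous g →
    (((∫ x, g x ∂(μ : Measure X)) / (∫ x, ψ x ∂(μ : Measure X)) : ℝ) : EReal) ≤
      inducedPressure f ψ (fun x => φ x + g x) - inducedPressure f ψ φ}

end Tangent

section InducedPressureFacts

lemma log_mul_inv_le_iff {q : ℝ≥0∞} {T K : ℝ} (hT : 0 < T) :
    ENNReal.log q * ((T⁻¹ : ℝ) : EReal) ≤ K ↔ q ≤ ENNReal.ofReal (Real.exp (K * T)) := by
  have h1 : ENNReal.log (ENNReal.ofReal (Real.exp (K * T))) = ((K * T : ℝ) : EReal) := by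
    rw [ENNReal.log_ofReal, if_neg (not_le.2 (Real.exp_pos _)), Real.log_exp]
  rw [← ENNReal.log_le_log_iff, h1, EReal.coe_inv, mul_comm, ← EReal.div_eq_inv_mul,
    EReal.div_le_iff_le_mul (by exact_mod_cast hT) (EReal.coe_ne_top _), mul_comm K T,
    EReal.coe_mul]

lemma le_log_mul_inv_iff {q : ℝ≥0∞} {T K : ℝ} (hT : 0 < T) :
    (K : EReal) ≤ ENNReal.log q * ((T⁻¹ : ℝ) : EReal) ↔
      ENNReal.ofReal (Real.exp (K * T)) ≤ q := by
  have h1 : ENNReal.log (ENNReal.ofReal (Real.exp (K * T))) = ((K * T : ℝ) : EReal) := by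
    rw [ENNReal.log_ofReal, if_neg (not_le.2 (Real.exp_pos _)), Real.log_exp]
  rw [← ENNReal.log_le_log_iff, h1, EReal.coe_inv, mul_comm, ← EReal.div_eq_inv_mul,
    EReal.le_div_iff_mul_le (by exact_mod_cast hT) (EReal.coe_ne_top _), EReal.coe_mul]

lemma birkhoff_add_coboundary (f : X → X) (φ g : X → ℝ) (n : ℕ) (x : X) :
    birkhoff f (fun x => φ x + (g (f x) - g x)) n x =
      birkhoff f φ n x + (g (f^[n] x) - g x) := by
  have := Finset.sum_range_sub (fun i => g (f^[i] x)) n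
  simp only [birkhoff, Finset.sum_add_distrib, ← Function.iterate_succ_apply' f]
  simpa using this

lemma le_birkhoff {f : X → X} {ψ : X → ℝ} {m : ℝ} (hm : ∀ x, m ≤ ψ x) (n : ℕ) (x : X) :
    n * m ≤ birkhoff f ψ n x := by
  simpa [birkhoff] using Finset.card_nsmul_le_sum (Finset.range n) (fun i => ψ (f^[i] x)) m
    fun i _ => hm _

lemma birkhoff_le {f : X → X} {ψ : X → ℝ} {M : ℝ} (hM : ∀ x, ψ x ≤ M) (n : ℕ) (x : X) :
    birkhoff f ψ n x ≤ n * M := by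
  simpa [birkhoff] using Finset.sum_le_card_nsmul (Finset.range n) (fun i => ψ (f^[i] x)) M
    fun i _ => hM _

variable [MetricSpace X]

lemma eventually_inducedQ_lt {f : X → X} {ψ φ : X → ℝ} {β : ℝ}
    (h : inducedPressure f ψ φ < β) :
    ∀ᶠ ε in 𝓝[>] (0 : ℝ), ∀ᶠ T in atTop,
      inducedQ f ψ φ T ε < ENNReal.ofReal (Real.exp (β * T)) := by
  filter_upwards [eventually_lt_of_limsup_lt h] with ε hε
  filter_upwards [eventually_lt_of_limsup_lt hε, eventually_gt_atTop 0] with T hT hT0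
  exact lt_of_not_ge fun h' => absurd hT (not_lt.2 ((le_log_mul_inv_iff hT0).2 h'))

lemma inducedPressure_le {f : X → X} {ψ φ : X → ℝ} {K : ℝ}
    (h : ∀ᶠ ε in 𝓝[>] (0 : ℝ), ∀ᶠ T in atTop,
      inducedQ f ψ φ T ε ≤ ENNReal.ofReal (Real.exp (K * T))) :
    inducedPressure f ψ φ ≤ K := by
  refine limsup_le_of_le (h := ?_)
  filter_upwards [h] with ε hε
  refine limsup_le_of_le (h := ?_)
  filter_upwards [hε, eventually_gt_atTop 0] with T hT hT0
  exact (log_mul_inv_le_iff hT0).2 hT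

lemma le_inducedPressure {f : X → X} {ψ φ : X → ℝ} {K : ℝ}
    (h : ∀ᶠ ε in 𝓝[>] (0 : ℝ), ∀ᶠ T in atTop,
      ENNReal.ofReal (Real.exp (K * T)) ≤ inducedQ f ψ φ T ε) :
    K ≤ inducedPressure f ψ φ := by
  refine le_limsup_of_frequently_le (Eventually.frequently ?_)
  filter_upwards [h] with ε hε
  refine le_limsup_of_frequently_le (Eventually.frequently ?_)
  filter_upwards [hε, eventually_gt_atTop 0] with T hT hT0
  exact (le_log_mul_inv_iff hT0).2 hT

/-- A uniformly bounded increase of Birkhoff sums does not increase the induced pressure. -/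
lemma inducedPressure_le_of_birkhoff_le {f : X → X} {ψ φ φ' : X → ℝ} (c : ℝ)
    (h : ∀ n x, birkhoff f φ' n x ≤ c + birkhoff f φ n x) :
    inducedPressure f ψ φ' ≤ inducedPressure f ψ φ := by
  refine EReal.le_of_forall_lt_iff_le.1 fun z hz => ?_
  obtain ⟨y, hy, hyz⟩ := EReal.lt_iff_exists_real_btwn.1 hz
  have hyz' : y < z := by exact_mod_cast hyz
  refine inducedPressure_le ?_
  filter_upwards [eventually_inducedQ_lt hy] with ε hε
  filter_upwards [hε, eventually_ge_atTop (c / (z - y))] with T hT hTc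
  have hcT : c ≤ (z - y) * T := by
    rw [div_le_iff₀ (by linarith)] at hTc; linarith
  obtain ⟨F, hF⟩ := iInf_lt_iff.1 hT
  obtain ⟨hs, hF⟩ := iInf_lt_iff.1 hF
  calc inducedQ f ψ φ' T ε
      ≤ ∑' n : inducedST f ψ T, ∑ x ∈ F n,
          ENNReal.ofReal (Real.exp (birkhoff f φ' n x)) := iInf₂_le F hs
    _ ≤ ∑' n : inducedST f ψ T, ENNReal.ofReal (Real.exp c) *
          ∑ x ∈ F n, ENNReal.ofReal (Real.exp (birkhoff f φ n x)) := by
        refine ENNReal.tsum_le_tsum fun n => ?_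
        rw [Finset.mul_sum]
        refine Finset.sum_le_sum fun x _ => ?_
        rw [← ENNReal.ofReal_mul (Real.exp_pos _).le, ← Real.exp_add]
        exact ENNReal.ofReal_le_ofReal (Real.exp_le_exp.2 (h _ _))
    _ ≤ ENNReal.ofReal (Real.exp c) * ENNReal.ofReal (Real.exp (y * T)) := by
        rw [ENNReal.tsum_mul_left]; gcongr
    _ ≤ ENNReal.ofReal (Real.exp (z * T)) := by
        rw [← ENNReal.ofReal_mul (Real.exp_pos _).le, ← Real.exp_add]
        exact ENNReal.ofReal_le_ofReal (Real.exp_le_exp.2 (by linarith))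

lemma exists_abs_le [CompactSpace X] {g : X → ℝ} (hg : Continuous g) :
    ∃ C, 0 ≤ C ∧ ∀ x, |g x| ≤ C := by
  obtain ⟨C, hC⟩ := isCompact_univ.exists_bound_of_continuousOn hg.continuousOn
  exact ⟨max C 0, le_max_right _ _, fun x => (hC x trivial).trans (le_max_left _ _)⟩

lemma exists_pos_le [CompactSpace X] {ψ : X → ℝ} (hψ : Continuous ψ)
    (hpos : ∀ x, 0 < ψ x) : ∃ m, 0 < m ∧ ∀ x, m ≤ ψ x := by
  obtain ⟨m, hm, h⟩ := isCompact_univ.exists_forall_le' hψ.continuousOn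
    (a := 0) fun x _ => hpos x
  exact ⟨m, hm, fun x => h x trivial⟩

lemma inducedPressure_add_coboundary_le [CompactSpace X] {f : X → X} {ψ φ g : X → ℝ}
    (hg : Continuous g) :
    inducedPressure f ψ (fun x => φ x + (g (f x) - g x)) ≤ inducedPressure f ψ φ := by
  obtain ⟨C, -, hC⟩ := exists_abs_le hg
  refine inducedPressure_le_of_birkhoff_le (2 * C) fun n x => ?_
  rw [birkhoff_add_coboundary]
  linarith [(abs_le.1 (hC (f^[n] x))).2, (abs_le.1 (hC x)).1]

omit [MetricSpace X] in
lemma mul_le_of_mem_inducedST {f : X → X} {ψ : X → ℝ} {m T : ℝ} (hm : ∀ x, m ≤ ψ x) {n : ℕ}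
    (hn : n ∈ inducedST f ψ T) : n * m ≤ T := by
  obtain ⟨x, hx, -⟩ := hn
  exact (le_birkhoff hm n x).trans hx

omit [MetricSpace X] in
lemma exists_mem_inducedXn {f : X → X} {ψ : X → ℝ} {m T : ℝ} (hm0 : 0 < m)
    (hm : ∀ x, m ≤ ψ x) (hT : 0 ≤ T) (x : X) : ∃ n, x ∈ inducedXn f ψ T n := by
  have hex : ∃ n : ℕ, T < birkhoff f ψ (n + 1) x := by
    obtain ⟨n, hn⟩ := exists_nat_gt (T / m)
    rw [div_lt_iff₀ hm0] at hn
    refine ⟨n, hn.trans_le (le_trans ?_ (le_birkhoff hm _ _))⟩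
    push_cast; linarith
  classical
  refine ⟨Nat.find hex, ?_, Nat.find_spec hex⟩
  rcases h : Nat.find hex with _ | k
  · simpa [birkhoff] using hT
  · exact not_lt.1 (Nat.find_min hex (m := k) (by omega))

lemma bot_lt_inducedPressure [CompactSpace X] [Nonempty X] {f : X → X} {ψ φ : X → ℝ}
    (hφ : Continuous φ) (hψ : Continuous ψ) (hpos : ∀ x, 0 < ψ x) :
    ⊥ < inducedPressure f ψ φ := by
  obtain ⟨m, hm0, hm⟩ := exists_pos_le hψ hpos
  obtain ⟨C, hC0, hC⟩ := exists_abs_le hφ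
  refine (EReal.bot_lt_coe (-(C / m))).trans_le (le_inducedPressure ?_)
  filter_upwards with ε
  filter_upwards [eventually_ge_atTop 0] with T hT
  refine le_iInf₂ fun F hF => ?_
  obtain ⟨x₀⟩ := ‹Nonempty X›
  obtain ⟨n, hn⟩ := exists_mem_inducedXn (f := f) hm0 hm hT x₀
  have hnS : n ∈ inducedST f ψ T := ⟨x₀, hn⟩
  obtain ⟨z, hz, -⟩ := hF n hnS x₀ hn
  refine le_trans ?_ (ENNReal.le_tsum ⟨n, hnS⟩)
  refine le_trans ?_ (Finset.single_le_sum (fun _ _ => zero_le) hz)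
  refine ENNReal.ofReal_le_ofReal (Real.exp_le_exp.2 ?_)
  refine le_trans ?_ (le_birkhoff (fun x => (abs_le.1 (hC x)).1) n z)
  have h1 : (n : ℝ) ≤ T / m := by
    rw [le_div_iff₀ hm0]; exact mul_le_of_mem_inducedST hm hnS
  have : -(C / m) * T = -(T / m * C) := by ring
  nlinarith

/-- Finite topological entropy yields spanning sets of at most exponential size. -/
lemma eventually_exists_spanning {f : X → X} (htop : topEntropy f < ⊤) :
    ∃ h : ℝ, 0 ≤ h ∧ ∀ᶠ ε in 𝓝[>] (0 : ℝ), ∃ N : ℕ, ∀ n : ℕ, ∃ F : Finset X,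
      IsSpanningSetOf f n ε univ F ∧ (F.card : ℝ) ≤ Real.exp (h * (n + N)) := by
  obtain ⟨h₀, hh₀, -⟩ := EReal.lt_iff_exists_real_btwn.1 htop
  have hh : inducedPressure f (fun _ => 1) (fun _ => 0) < ((max h₀ 0 : ℝ) : EReal) :=
    hh₀.trans_le (by exact_mod_cast le_max_left _ _)
  refine ⟨max h₀ 0, le_max_right _ _, ?_⟩
  filter_upwards [eventually_inducedQ_lt hh] with ε hε
  obtain ⟨T₀, hT₀⟩ := eventually_atTop.1 hε
  refine ⟨⌈T₀⌉₊, fun n => ?_⟩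
  have hT := hT₀ ((n + ⌈T₀⌉₊ : ℕ) : ℝ) (by
    push_cast; linarith [Nat.le_ceil T₀, (Nat.cast_nonneg n : (0 : ℝ) ≤ n)])
  obtain ⟨F, hF⟩ := iInf_lt_iff.1 hT
  obtain ⟨hs, hF⟩ := iInf_lt_iff.1 hF
  rcases isEmpty_or_nonempty X with hX | ⟨⟨x₀⟩⟩
  · exact ⟨∅, fun y => isEmptyElim y, by simpa using (Real.exp_pos _).le⟩
  have hall : ∀ x : X, x ∈ inducedXn f (fun _ => 1) ((n + ⌈T₀⌉₊ : ℕ) : ℝ) (n + ⌈T₀⌉₊) := by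
    intro x
    simp [inducedXn, birkhoff]
  have hmem : n + ⌈T₀⌉₊ ∈ inducedST f (fun _ => 1) ((n + ⌈T₀⌉₊ : ℕ) : ℝ) := ⟨x₀, hall x₀⟩
  refine ⟨F (n + ⌈T₀⌉₊), fun y _ => ?_, ?_⟩
  · obtain ⟨z, hz, h⟩ := hs _ hmem y (hall y)
    exact ⟨z, hz, fun i hi => h i (by omega)⟩
  · have h1 := (ENNReal.le_tsum (f := fun k : inducedST f (fun _ => 1) ((n + ⌈T₀⌉₊ : ℕ) : ℝ) =>
      ∑ x ∈ F k, ENNReal.ofReal (Real.exp (birkhoff f (fun _ => 0) k x))) ⟨_, hmem⟩).trans hF.le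
    simp only [birkhoff, Finset.sum_const_zero, Real.exp_zero, ENNReal.ofReal_one,
      Finset.sum_const, nsmul_eq_mul, mul_one] at h1
    rw [← ENNReal.ofReal_natCast, ENNReal.ofReal_le_ofReal_iff (Real.exp_pos _).le] at h1
    simpa using h1

lemma inducedPressure_lt_top [CompactSpace X] {f : X → X} {ψ φ : X → ℝ}
    (htop : topEntropy f < ⊤)
    (hφ : Continuous φ) (hψ : Continuous ψ) (hpos : ∀ x, 0 < ψ x) :
    inducedPressure f ψ φ < ⊤ := by
  obtain ⟨m, hm0, hm⟩ := exists_pos_le hψ hpos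
  obtain ⟨C, hC0, hC⟩ := exists_abs_le hφ
  obtain ⟨h, hh0, hspan⟩ := eventually_exists_spanning htop
  refine lt_of_le_of_lt (inducedPressure_le (K := (h + C + 1) / m + 1) ?_) (EReal.coe_lt_top _)
  filter_upwards [hspan] with ε ⟨N, hN⟩
  choose F hF hcard using hN
  have hr : Real.exp (-1) < 1 := by simp
  have hgeom :
      (∑' n : ℕ, ENNReal.ofReal (Real.exp (-n))) = ENNReal.ofReal (1 - Real.exp (-1))⁻¹ := by
    have : ∀ n : ℕ, Real.exp (-n) = Real.exp (-1) ^ n := fun n => by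
      rw [← Real.exp_nat_mul]; ring_nf
    simp only [this]
    rw [← ENNReal.ofReal_tsum_of_nonneg (fun n => by positivity)
      (summable_geometric_of_lt_one (Real.exp_pos _).le hr),
      tsum_geometric_of_lt_one (Real.exp_pos _).le hr]
  set G := (1 - Real.exp (-1))⁻¹ with hG
  have hGpos : 0 < G := inv_pos.2 (by linarith)
  filter_upwards [eventually_ge_atTop (h * N + Real.log G), eventually_ge_atTop 0] with T hT hT0
  calc inducedQ f ψ φ T ε
      ≤ ∑' n : inducedST f ψ T, ∑ x ∈ F n,
          ENNReal.ofReal (Real.exp (birkhoff f φ n x)) :=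
        iInf₂_le F fun n _ y _ => hF n y trivial
    _ ≤ ∑' n : inducedST f ψ T, ENNReal.ofReal (Real.exp (h * N + (h + C + 1) * (T / m))) *
          ENNReal.ofReal (Real.exp (-(n : ℕ))) := by
        refine ENNReal.tsum_le_tsum fun n => ?_
        rw [← ENNReal.ofReal_sum_of_nonneg (fun _ _ => (Real.exp_pos _).le),
          ← ENNReal.ofReal_mul (Real.exp_pos _).le]
        refine ENNReal.ofReal_le_ofReal ?_
        have hn : ((n : ℕ) : ℝ) ≤ T / m := by
          rw [le_div_iff₀ hm0]; exact mul_le_of_mem_inducedST hm n.2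
        calc ∑ x ∈ F n, Real.exp (birkhoff f φ n x)
            ≤ (F n).card • Real.exp ((n : ℕ) * C) :=
              Finset.sum_le_card_nsmul _ _ _ fun x _ =>
                Real.exp_le_exp.2 (birkhoff_le (fun x => (abs_le.1 (hC x)).2) _ _)
          _ ≤ Real.exp (h * ((n : ℕ) + N)) * Real.exp ((n : ℕ) * C) := by
              rw [nsmul_eq_mul]
              exact mul_le_mul_of_nonneg_right (hcard n) (Real.exp_pos _).le
          _ ≤ _ := by
              rw [← Real.exp_add, ← Real.exp_add]
              refine Real.exp_le_exp.2 ?_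
              nlinarith
    _ ≤ ENNReal.ofReal (Real.exp (h * N + (h + C + 1) * (T / m))) * ENNReal.ofReal G := by
        rw [ENNReal.tsum_mul_left, ← hgeom]
        gcongr
        exact ENNReal.tsum_comp_le_tsum_of_injective Subtype.val_injective
          (fun n : ℕ => ENNReal.ofReal (Real.exp (-n)))
    _ ≤ ENNReal.ofReal (Real.exp (((h + C + 1) / m + 1) * T)) := by
        rw [← ENNReal.ofReal_mul (Real.exp_pos _).le]
        refine ENNReal.ofReal_le_ofReal ?_
        nth_rw 1 [← Real.exp_log hGpos]
        rw [← Real.exp_add]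
        refine Real.exp_le_exp.2 ?_
        have : (h + C + 1) / m * T = (h + C + 1) * (T / m) := by ring
        linarith

lemma eventually_dist_le_imp_abs_sub_le [CompactSpace X] {g : X → ℝ} (hg : Continuous g)
    {ω : ℝ} (hω : 0 < ω) :
    ∀ᶠ ε in 𝓝[>] (0 : ℝ), ∀ x y, dist x y ≤ ε → |g x - g y| ≤ ω := by
  obtain ⟨δ, hδ, h⟩ := Metric.uniformContinuous_iff.1
    (CompactSpace.uniformContinuous_of_continuous hg) ω hω
  filter_upwards [Ioo_mem_nhdsGT hδ] with ε hε x y hxy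
  exact (h (hxy.trans_lt hε.2)).le

lemma abs_birkhoff_sub_le {f : X → X} {g : X → ℝ} {ε ω : ℝ}
    (hg : ∀ x y, dist x y ≤ ε → |g x - g y| ≤ ω) {n : ℕ} {x y : X}
    (hxy : ∀ i < n, dist (f^[i] x) (f^[i] y) ≤ ε) :
    |birkhoff f g n x - birkhoff f g n y| ≤ n * ω := by
  rw [birkhoff, birkhoff, ← Finset.sum_sub_distrib]
  refine (Finset.abs_sum_le_sum_abs _ _).trans ?_
  simpa using Finset.sum_le_card_nsmul (Finset.range n) _ ω fun i hi =>
    hg _ _ (hxy i (Finset.mem_range.1 hi))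

omit [MetricSpace X] in
lemma sum_biUnion_le_of_nonneg [DecidableEq X] {ι : Type*} (s : Finset ι) (t : ι → Finset X)
    {g : X → ℝ} (hg : ∀ x, 0 ≤ g x) : ∑ x ∈ s.biUnion t, g x ≤ ∑ i ∈ s, ∑ x ∈ t i, g x := by
  classical
  induction s using Finset.induction_on with
  | empty => simp
  | insert a s ha ih =>
    rw [Finset.biUnion_insert, Finset.sum_insert ha]
    have := Finset.sum_union_inter (s₁ := t a) (s₂ := s.biUnion t) (f := g)
    have := Finset.sum_nonneg (s := t a ∩ s.biUnion t) fun i _ => hg i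
    linarith

/-- Strict subexponential control: if the induced pressure of `φ` is below `β`, then the partition
sums of `φ - β ψ` over suitable spanning sets of the whole space stay bounded. -/
lemma eventually_exists_spanning_sum_le [CompactSpace X] {f : X → X} {ψ φ : X → ℝ}
    (hψ : Continuous ψ) (hpos : ∀ x, 0 < ψ x) {β : ℝ} (hβ : inducedPressure f ψ φ < β) :
    ∀ᶠ ε in 𝓝[>] (0 : ℝ), ∃ C : ℝ, ∀ᶠ n : ℕ in atTop, ∃ F : Finset X,
      IsSpanningSetOf f n ε univ F ∧
        ∑ z ∈ F, Real.exp (birkhoff f (fun x => φ x - β * ψ x) n z) ≤ C := by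
  classical
  obtain ⟨m, hm0, hm⟩ := exists_pos_le hψ hpos
  obtain ⟨M, hM0, hM⟩ := exists_abs_le hψ
  replace hM : ∀ x, ψ x ≤ M := fun x => (abs_le.1 (hM x)).2
  obtain ⟨y, hy, hyβ⟩ := EReal.lt_iff_exists_real_btwn.1 hβ
  replace hyβ : y < β := by exact_mod_cast hyβ
  set c := (β - y) * m / 2 with hc
  have hc0 : 0 < c := by have := mul_pos (sub_pos.2 hyβ) hm0; positivity
  set ω := c / (|β| + 1) with hω
  have hω0 : 0 < ω := by positivity
  have hβω : |β| * ω ≤ c := by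
    have : ω * (|β| + 1) = c := div_mul_cancel₀ _ (by positivity)
    nlinarith
  have hr : Real.exp (-c) < 1 := by simpa using hc0
  filter_upwards [eventually_inducedQ_lt hy, eventually_dist_le_imp_abs_sub_le hψ hω0]
    with ε hε hψε
  obtain ⟨T₀, hT₀⟩ := eventually_atTop.1 hε
  refine ⟨Real.exp (|β| * M) * (1 - Real.exp (-c))⁻¹, ?_⟩
  filter_upwards [eventually_ge_atTop ⌈T₀ / m⌉₊] with n hn
  have hex : ∀ j : ℕ, ∃ F : Finset X, n ≤ j →
      (n ∈ inducedST f ψ (m * j) →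
        IsSpanningSetOf f n ε (inducedXn f ψ (m * j) n) F ∧
        ∑ z ∈ F, Real.exp (birkhoff f φ n z) ≤ Real.exp (y * (m * j))) := by
    intro j
    by_cases hj : n ≤ j
    swap
    · exact ⟨∅, fun h => absurd h hj⟩
    have hT : T₀ ≤ m * j := by
      rw [← div_le_iff₀' hm0]
      exact (Nat.le_ceil _).trans (by exact_mod_cast hn.trans hj)
    obtain ⟨F, hF⟩ := iInf_lt_iff.1 (hT₀ _ hT)
    obtain ⟨hs, hF⟩ := iInf_lt_iff.1 hF
    refine ⟨F n, fun _ hmem => ⟨hs n hmem, ?_⟩⟩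
    have h1 := (ENNReal.le_tsum (f := fun k : inducedST f ψ (m * j) =>
      ∑ x ∈ F k, ENNReal.ofReal (Real.exp (birkhoff f φ k x))) ⟨_, hmem⟩).trans hF.le
    rwa [← ENNReal.ofReal_sum_of_nonneg (fun _ _ => (Real.exp_pos _).le),
      ENNReal.ofReal_le_ofReal_iff (Real.exp_pos _).le] at h1
  choose F hF using hex
  set G : ℕ → Finset X := fun j => {z ∈ F j | ∃ x ∈ inducedXn f ψ (m * j) n,
    ∀ i < n, dist (f^[i] z) (f^[i] x) ≤ ε} with hG
  have hGsum : ∀ j, n ≤ j → ∑ z ∈ G j, Real.exp (birkhoff f (fun x => φ x - β * ψ x) n z) ≤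
      Real.exp (|β| * M) * Real.exp (-c) ^ j := by
    intro j hj
    rcases (G j).eq_empty_or_nonempty with h0 | ⟨z₀, hz₀⟩
    · rw [h0, Finset.sum_empty]; positivity
    obtain ⟨x₀, hx₀, -⟩ := (Finset.mem_filter.1 hz₀).2
    obtain ⟨-, hsum⟩ := hF j hj ⟨x₀, hx₀⟩
    have key : ∀ z ∈ G j, Real.exp (birkhoff f (fun x => φ x - β * ψ x) n z) ≤
        Real.exp (birkhoff f φ n z) * Real.exp (-(β * (m * j)) + |β| * (n * ω + M)) := by
      intro z hz
      obtain ⟨x, hx, hzx⟩ := (Finset.mem_filter.1 hz).2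
      have h1 : birkhoff f (fun x => φ x - β * ψ x) n z =
          birkhoff f φ n z - β * birkhoff f ψ n z := by
        simp [birkhoff, Finset.sum_sub_distrib, Finset.mul_sum]
      have h2 := abs_birkhoff_sub_le hψε hzx
      have h3 : birkhoff f ψ (n + 1) x = birkhoff f ψ n x + ψ (f^[n] x) :=
        Finset.sum_range_succ _ _
      have h4 : |m * j - birkhoff f ψ n z| ≤ n * ω + M := by
        have := hM (f^[n] x)
        have ha := abs_le.1 h2
        have hb := hx.1
        have hc := hx.2
        rw [abs_le]
        constructor <;> linarith
      have h5 : β * (m * j - birkhoff f ψ n z) ≤ |β| * (n * ω + M) :=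
        (le_abs_self _).trans (by rw [abs_mul]; gcongr)
      rw [← Real.exp_add, h1]
      exact Real.exp_le_exp.2 (by linarith)
    calc ∑ z ∈ G j, Real.exp (birkhoff f (fun x => φ x - β * ψ x) n z)
        ≤ ∑ z ∈ G j, Real.exp (birkhoff f φ n z) *
            Real.exp (-(β * (m * j)) + |β| * (n * ω + M)) := Finset.sum_le_sum key
      _ ≤ Real.exp (y * (m * j)) * Real.exp (-(β * (m * j)) + |β| * (n * ω + M)) := by
          rw [← Finset.sum_mul]
          gcongr
          exact (Finset.sum_le_sum_of_subset_of_nonneg (Finset.filter_subset _ _)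
            fun _ _ _ => (Real.exp_pos _).le).trans hsum
      _ ≤ Real.exp (|β| * M) * Real.exp (-c) ^ j := by
          rw [← Real.exp_nat_mul, ← Real.exp_add, ← Real.exp_add]
          refine Real.exp_le_exp.2 ?_
          have h6 : (n : ℝ) * (|β| * ω) ≤ j * c := by
            have : (n : ℝ) ≤ j := by exact_mod_cast hj
            gcongr
          have h7 : (β - y) * m * j = 2 * (j * c) := by rw [hc]; ring
          linarith
  refine ⟨(Finset.Ico n ⌈n * M / m + 1⌉₊).biUnion G, fun x _ => ?_, ?_⟩
  · have hS0 : 0 ≤ birkhoff f ψ n x / m :=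
      div_nonneg ((by positivity : (0 : ℝ) ≤ n * m).trans (le_birkhoff hm n x)) hm0.le
    set j := ⌈birkhoff f ψ n x / m⌉₊ with hj
    have hjlt : (j : ℝ) < birkhoff f ψ n x / m + 1 := Nat.ceil_lt_add_one hS0
    have hnj : n ≤ j := by
      have : (n : ℝ) ≤ j := le_trans (by
        rw [le_div_iff₀ hm0]; exact le_birkhoff hm n x) (Nat.le_ceil _)
      exact_mod_cast this
    have hx : x ∈ inducedXn f ψ (m * j) n := by
      constructor
      · rw [← div_le_iff₀' hm0]; exact Nat.le_ceil _
      · have h3 : birkhoff f ψ (n + 1) x = birkhoff f ψ n x + ψ (f^[n] x) :=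
          Finset.sum_range_succ _ _
        have h4 := mul_lt_mul_of_pos_left hjlt hm0
        have h5 : m * (birkhoff f ψ n x / m + 1) = birkhoff f ψ n x + m := by
          field_simp
        linarith [hm (f^[n] x)]
    obtain ⟨z, hz, hzx⟩ := (hF j hnj ⟨x, hx⟩).1 x hx
    refine ⟨z, Finset.mem_biUnion.2 ⟨j, Finset.mem_Ico.2 ⟨hnj, ?_⟩,
      Finset.mem_filter.2 ⟨hz, x, hx, hzx⟩⟩, hzx⟩
    have h6 : birkhoff f ψ n x / m ≤ n * M / m := by
      gcongr; exact birkhoff_le hM n x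
    exact_mod_cast (hjlt.trans_le (by linarith)).trans_le (Nat.le_ceil (n * M / m + 1))
  · calc ∑ z ∈ (Finset.Ico n ⌈n * M / m + 1⌉₊).biUnion G,
          Real.exp (birkhoff f (fun x => φ x - β * ψ x) n z)
        ≤ ∑ j ∈ Finset.Ico n ⌈n * M / m + 1⌉₊, ∑ z ∈ G j,
          Real.exp (birkhoff f (fun x => φ x - β * ψ x) n z) :=
          sum_biUnion_le_of_nonneg _ _ fun _ => (Real.exp_pos _).le
      _ ≤ ∑ j ∈ Finset.Ico n ⌈n * M / m + 1⌉₊, Real.exp (|β| * M) * Real.exp (-c) ^ j :=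
          Finset.sum_le_sum fun j hj => hGsum j (Finset.mem_Ico.1 hj).1
      _ ≤ Real.exp (|β| * M) * (1 - Real.exp (-c))⁻¹ := by
          rw [← Finset.mul_sum, ← tsum_geometric_of_lt_one (Real.exp_pos _).le hr]
          gcongr
          exact (summable_geometric_of_lt_one (Real.exp_pos _).le hr).sum_le_tsum _
            fun _ _ => by positivity

end InducedPressureFacts

section EntropyFacts

/-- **Gibbs' inequality**. -/
lemma sum_negMulLog_le {S : Type*} [Fintype S] {P q : S → ℝ} (hP : ∀ s, 0 ≤ P s)
    (hP1 : ∑ s, P s = 1) (hq : ∀ s, 0 < q s) (hq1 : ∑ s, q s ≤ 1) :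
    ∑ s, Real.negMulLog (P s) ≤ ∑ s, P s * -Real.log (q s) := by
  have key : ∀ s, Real.negMulLog (P s) ≤ P s * -Real.log (q s) + (q s - P s) := by
    intro s
    rcases (hP s).eq_or_lt with h | h
    · simpa [← h] using (hq s).le
    · have h1 := Real.log_le_sub_one_of_pos (div_pos (hq s) h)
      rw [Real.log_div (hq s).ne' h.ne'] at h1
      have h2 := mul_le_mul_of_nonneg_left h1 h.le
      have h3 : P s * (q s / P s - 1) = q s - P s := by field_simp
      rw [Real.negMulLog]
      linarith
  have := Finset.sum_le_sum fun s (_ : s ∈ Finset.univ) => key s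
  rw [Finset.sum_add_distrib, Finset.sum_sub_distrib] at this
  linarith

variable [MetricSpace X] [MeasurableSpace X] [BorelSpace X]

omit [MetricSpace X] [BorelSpace X] in
lemma mapEntropy_le_integral {S : Type*} [Fintype S] [MeasurableSpace S]
    [MeasurableSingletonClass S] {μ : Measure X} [IsProbabilityMeasure μ] {g : X → S}
    (hg : Measurable g) {q : S → ℝ} (hq : ∀ s, 0 < q s) (hq1 : ∑ s, q s ≤ 1) :
    mapEntropy μ g ≤ ∫ x, -Real.log (q (g x)) ∂μ := by
  have : IsProbabilityMeasure (μ.map g) := Measure.isProbabilityMeasure_map hg.aemeasurable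
  have hreal : ∀ s, (μ.map g).real {s} = (μ (g ⁻¹' {s})).toReal := fun s => by
    rw [measureReal_def, Measure.map_apply hg (measurableSet_singleton s)]
  rw [← integral_map (φ := g) (f := fun s => -Real.log (q s)) hg.aemeasurable
    (measurable_of_finite _).aestronglyMeasurable, integral_fintype (Integrable.of_finite)]
  simp only [smul_eq_mul, mapEntropy, ← hreal]
  refine sum_negMulLog_le (fun _ => measureReal_nonneg) ?_ hq hq1
  simp

lemma integrable_of_continuous [CompactSpace X] {μ : Measure X} [IsFiniteMeasure μ] {g : X → ℝ}
    (hg : Continuous g) : Integrable g μ :=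
  hg.integrable_of_hasCompactSupport (HasCompactSupport.of_compactSpace _)

lemma integral_birkhoff [CompactSpace X] {μ : Measure X} [IsFiniteMeasure μ] {f : X → X}
    (hf : Continuous f) (hμ : MeasurePreserving f μ μ) {χ : X → ℝ} (hχ : Continuous χ) (n : ℕ) :
    ∫ x, birkhoff f χ n x ∂μ = n * ∫ x, χ x ∂μ := by
  simp only [birkhoff]
  rw [integral_finsetSum _ fun i _ =>
    integrable_of_continuous (g := fun x => χ (f^[i] x)) (hχ.comp (hf.iterate i))]
  have : ∀ i, ∫ x, χ (f^[i] x) ∂μ = ∫ x, χ x ∂μ := fun i => by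
    have h := (hμ.iterate i).map_eq
    conv_rhs => rw [← h]
    rw [integral_map (hμ.iterate i).measurable.aemeasurable hχ.aestronglyMeasurable]
  simp [this]

/-- The entropy of length-`n` itineraries is controlled by the partition sum of a spanning set,
provided that the partition can be read off, up to the exceptional set `Aᶜ`, from
`ε`-approximations. -/
lemma mapEntropy_itinerary_le [CompactSpace X] {μ : Measure X} [IsProbabilityMeasure μ]
    {f : X → X} (hf : Continuous f) (hμ : MeasurePreserving f μ μ) {χ : X → ℝ}
    (hχ : Continuous χ) {k : ℕ} {p y : X → Fin k} (hp : Measurable p) {A : Set X}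
    (hA : MeasurableSet A) {δ ε ω C : ℝ} (hδ0 : 0 < δ) (hδ1 : δ < 1)
    (hχε : ∀ x y, dist x y ≤ ε → |χ x - χ y| ≤ ω)
    (hy : ∀ x ∈ A, ∀ w, dist w x ≤ ε → y w = p x) {n : ℕ} {F : Finset X}
    (hF : IsSpanningSetOf f n ε univ F) (hC : ∑ z ∈ F, Real.exp (birkhoff f χ n z) ≤ C) :
    mapEntropy μ (fun x (i : Fin n) => p (f^[i] x)) ≤
      Real.log C + n * (ω - ∫ x, χ x ∂μ + (-Real.log (1 - δ) + -Real.log (δ / k) * μ.real Aᶜ)) := by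
  classical
  have : Nonempty X := nonempty_of_isProbabilityMeasure μ
  obtain ⟨x₀⟩ := this
  have hk : 0 < k := (p x₀).pos
  have hk' : (0 : ℝ) < k := by exact_mod_cast hk
  have hFne : F.Nonempty := by obtain ⟨z, hz, -⟩ := hF x₀ trivial; exact ⟨z, hz⟩
  set Z := ∑ z ∈ F, Real.exp (birkhoff f χ n z) with hZ
  have hZ0 : 0 < Z := Finset.sum_pos (fun _ _ => Real.exp_pos _) hFne
  set r : Fin k → X → ℝ := fun a w => (1 - δ) * (if a = y w then 1 else 0) + δ / k with hr
  have hδk : 0 < δ / k := div_pos hδ0 hk'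
  have hr_ge : ∀ a w, δ / k ≤ r a w := fun a w => by
    simp only [hr]
    split_ifs <;> nlinarith
  have hr_pos : ∀ a w, 0 < r a w := fun a w => hδk.trans_le (hr_ge a w)
  have hr_sum : ∀ w, ∑ a, r a w = 1 := fun w => by
    simp only [hr, Finset.sum_add_distrib, ← Finset.mul_sum]
    simp
    field_simp
    ring
  set q : (Fin n → Fin k) → ℝ := fun a =>
    Z⁻¹ * ∑ z ∈ F, Real.exp (birkhoff f χ n z) * ∏ i : Fin n, r (a i) (f^[i] z) with hq
  have hprod_pos : ∀ (a : Fin n → Fin k) z, 0 < ∏ i : Fin n, r (a i) (f^[i] z) :=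
    fun a z => Finset.prod_pos fun i _ => hr_pos _ _
  have hq_pos : ∀ a, 0 < q a := fun a => mul_pos (inv_pos.2 hZ0)
    (Finset.sum_pos (fun z _ => mul_pos (Real.exp_pos _) (hprod_pos a z)) hFne)
  have hq_sum : ∑ a, q a ≤ 1 := by
    simp only [hq]
    rw [← Finset.mul_sum, Finset.sum_comm]
    have h1 : ∀ z, ∑ a : Fin n → Fin k, ∏ i : Fin n, r (a i) (f^[i] z) = 1 := fun z => by
      have := Finset.prod_univ_sum (fun _ : Fin n => (Finset.univ : Finset (Fin k)))
        (fun i a => r a (f^[i] z))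
      rw [Fintype.piFinset_univ] at this
      rw [← this]
      simp [hr_sum]
    simp only [← Finset.mul_sum, h1, mul_one]
    rw [← hZ, inv_mul_cancel₀ hZ0.ne']
  have hmeas : Measurable (fun x (i : Fin n) => p (f^[i] x)) :=
    measurable_pi_lambda _ fun i => hp.comp (hf.iterate i).measurable
  set c₀ := -Real.log (1 - δ) with hc₀
  set c₁ := -Real.log (δ / k) with hc₁
  have hc₀0 : 0 ≤ c₀ := by
    have := Real.log_nonpos (by linarith) (by linarith : 1 - δ ≤ 1); linarith
  have hδk1 : δ / k ≤ 1 := by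
    rw [div_le_one hk']
    have : (1 : ℝ) ≤ k := by exact_mod_cast hk
    linarith
  have hc₁0 : 0 ≤ c₁ := by
    have := Real.log_nonpos hδk.le hδk1; linarith
  have hlogr : ∀ (x z : X), dist z x ≤ ε →
      -Real.log (r (p x) z) ≤ c₀ + c₁ * Aᶜ.indicator (fun _ => (1 : ℝ)) x := by
    intro x z hzx
    by_cases hx : x ∈ A
    · have h1 : 1 - δ ≤ r (p x) z := by
        simp only [hr, hy x hx z hzx, if_true]; linarith
      have := Real.log_le_log (by linarith) h1
      simp only [Set.indicator_of_notMem (Set.notMem_compl_iff.2 hx), mul_zero, add_zero]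
      linarith
    · have := Real.log_le_log hδk (hr_ge (p x) z)
      simp only [Set.indicator_of_mem (Set.mem_compl hx), mul_one]
      linarith
  have hpt : ∀ x, -Real.log (q (fun i : Fin n => p (f^[i] x))) ≤
      Real.log C + n * (ω + c₀) - birkhoff f χ n x +
        c₁ * birkhoff f (Aᶜ.indicator fun _ => (1 : ℝ)) n x := by
    intro x
    obtain ⟨z, hz, hzx⟩ := hF x trivial
    have h1 : Z⁻¹ * (Real.exp (birkhoff f χ n z) *
        ∏ i : Fin n, r (p (f^[i] x)) (f^[i] z)) ≤ q (fun i : Fin n => p (f^[i] x)) := by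
      simp only [hq]
      gcongr
      exact Finset.single_le_sum (f := fun z => Real.exp (birkhoff f χ n z) *
        ∏ i : Fin n, r (p (f^[i] x)) (f^[i] z))
        (fun z _ => (mul_pos (Real.exp_pos _) (hprod_pos _ z)).le) hz
    have hpp := hprod_pos (fun i : Fin n => p (f^[i] x)) z
    have h2 := Real.log_le_log (by positivity) h1
    rw [Real.log_mul (by positivity) (by positivity), Real.log_mul (by positivity) hpp.ne',
      Real.log_exp, Real.log_inv, Real.log_prod fun i _ => (hr_pos _ _).ne'] at h2
    have h3 := Real.log_le_log hZ0 hC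
    have h4 := (abs_le.1 (abs_birkhoff_sub_le hχε hzx)).1
    have h5 : ∑ i : Fin n, -Real.log (r (p (f^[i] x)) (f^[i] z)) ≤
        n * c₀ + c₁ * birkhoff f (Aᶜ.indicator fun _ => (1 : ℝ)) n x := by
      refine (Finset.sum_le_sum fun (i : Fin n) _ => hlogr _ _ (hzx _ i.2)).trans_eq ?_
      rw [Finset.sum_add_distrib, ← Finset.mul_sum, birkhoff, ← Fin.sum_univ_eq_sum_range
        (fun i => Aᶜ.indicator (fun _ => (1 : ℝ)) (f^[i] x))]
      simp
    rw [Finset.sum_neg_distrib] at h5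
    linarith
  have hintegrableχ : Integrable (birkhoff f χ n) μ := integrable_finsetSum _ fun i _ =>
    integrable_of_continuous (hχ.comp (hf.iterate i))
  have hintA : ∀ i, Integrable (fun x => Aᶜ.indicator (fun _ => (1 : ℝ)) (f^[i] x)) μ := fun i =>
    (hμ.iterate i).integrable_comp_of_integrable ((integrable_const 1).indicator hA.compl)
  have hintA' : Integrable (birkhoff f (Aᶜ.indicator fun _ => (1 : ℝ)) n) μ :=
    integrable_finsetSum _ fun i _ => hintA i
  have hAint : ∫ x, birkhoff f (Aᶜ.indicator fun _ => (1 : ℝ)) n x ∂μ = n * μ.real Aᶜ := by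
    simp only [birkhoff]
    rw [integral_finsetSum _ fun i _ => hintA i]
    have : ∀ i, ∫ x, Aᶜ.indicator (fun _ => (1 : ℝ)) (f^[i] x) ∂μ = μ.real Aᶜ := fun i => by
      rw [← integral_map (hμ.iterate i).measurable.aemeasurable
        ((measurable_const.indicator hA.compl).aestronglyMeasurable), (hμ.iterate i).map_eq,
        integral_indicator hA.compl]
      simp
    simp [this]
  refine (mapEntropy_le_integral hmeas hq_pos hq_sum).trans ?_
  have hint1 : Integrable (fun x => Real.log C + n * (ω + c₀) - birkhoff f χ n x) μ :=
    (integrable_const _).sub hintegrableχ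
  have hint2 : Integrable
      (fun x => c₁ * birkhoff f (Aᶜ.indicator fun _ => (1 : ℝ)) n x) μ := hintA'.const_mul _
  have hint3 : Integrable (fun x => -Real.log (q (fun i : Fin n => p (f^[i] x)))) μ :=
    Integrable.comp_measurable (f := fun x (i : Fin n) => p (f^[i] x))
      (g := fun a => -Real.log (q a)) Integrable.of_finite hmeas
  refine (integral_mono hint3 (hint1.add hint2) hpt).trans_eq ?_
  rw [integral_add' hint1 hint2, integral_sub (integrable_const _) hintegrableχ, integral_const_mul,
    hAint, integral_birkhoff hf hμ hχ]
  simp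
  ring

/-- Up to small measure, a finite measurable partition can be read off from sufficiently fine
approximations. -/
lemma exists_approx_coding {μ : Measure X} [IsFiniteMeasure μ] {k : ℕ}
    {p : X → Fin k} (hp : Measurable p) [CompactSpace X] {ρ : ℝ} (hρ : 0 < ρ) :
    ∃ A : Set X, MeasurableSet A ∧ μ.real Aᶜ ≤ ρ ∧
      ∀ᶠ ε in 𝓝[>] (0 : ℝ), ∃ y : X → Fin k, ∀ x ∈ A, ∀ w, dist w x ≤ ε → y w = p x := by
  classical
  rcases isEmpty_or_nonempty X with hX | ⟨⟨x₀⟩⟩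
  · exact ⟨∅, .empty, by simp [measureReal_def, Set.eq_empty_of_isEmpty, hρ.le],
      Eventually.of_forall fun _ => ⟨p, by simp⟩⟩
  have hk : (0 : ℝ) < k := by exact_mod_cast (p x₀).pos
  have hB : ∀ i, ∃ B ⊆ p ⁻¹' {i}, IsClosed B ∧ μ (p ⁻¹' {i} \ B) < ENNReal.ofReal (ρ / k) :=
    fun i => (hp (measurableSet_singleton i)).exists_isClosed_sdiff_lt (measure_ne_top _ _)
      (by simpa using div_pos hρ hk)
  choose B hBp hBc hBμ using hB
  refine ⟨⋃ i, B i, .iUnion fun i => (hBc i).measurableSet, ?_, ?_⟩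
  · have hsub : (⋃ i, B i)ᶜ ⊆ ⋃ i, p ⁻¹' {i} \ B i := fun x hx =>
      Set.mem_iUnion.2 ⟨p x, rfl, fun h => hx (Set.mem_iUnion.2 ⟨_, h⟩)⟩
    calc μ.real (⋃ i, B i)ᶜ ≤ μ.real (⋃ i, p ⁻¹' {i} \ B i) := measureReal_mono hsub
      _ ≤ ∑ i, μ.real (p ⁻¹' {i} \ B i) := measureReal_iUnion_fintype_le _
      _ ≤ ∑ i : Fin k, ρ / k := Finset.sum_le_sum fun i _ =>
          ENNReal.toReal_le_of_le_ofReal (div_pos hρ hk).le (hBμ i).le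
      _ = ρ := by simp; field_simp
  · have hsep : ∀ᶠ ε in 𝓝[>] (0 : ℝ), ∀ i j, i ≠ j → ∀ x ∈ B i, ∀ x' ∈ B j,
        2 * ε < dist x x' := by
      refine eventually_all.2 fun i => eventually_all.2 fun j => ?_
      by_cases hij : i = j
      · exact Eventually.of_forall fun _ h => absurd hij h
      have hdisj : Disjoint (B i) (B j) := Set.disjoint_left.2 fun x hi hj =>
        hij ((hBp i hi).symm.trans (hBp j hj))
      obtain ⟨r, hr0, hr⟩ :=
        Metric.exists_pos_forall_lt_edist (hBc i).isCompact (hBc j) hdisj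
      have hr0' : (0 : ℝ) < r / 2 := by positivity
      filter_upwards [Ioo_mem_nhdsGT hr0'] with ε hε _ x hx x' hx'
      have h1 := hr x hx x' hx'
      rw [edist_nndist, ENNReal.coe_lt_coe] at h1
      have h2 : (r : ℝ) < dist x x' := h1
      linarith [hε.2]
    filter_upwards [hsep] with ε hε
    refine ⟨fun w => if h : ∃ j, ∃ b ∈ B j, dist w b ≤ ε then h.choose else p w, ?_⟩
    intro x hx w hwx
    obtain ⟨j, hj⟩ := Set.mem_iUnion.1 hx
    have hex : ∃ j, ∃ b ∈ B j, dist w b ≤ ε := ⟨j, x, hj, hwx⟩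
    obtain ⟨b, hb, hwb⟩ := hex.choose_spec
    have hjp : p x = j := hBp j hj
    simp only [dif_pos hex, hjp]
    by_contra hne
    have := hε _ _ hne b hb x hj
    have h2 := dist_triangle b w x
    rw [dist_comm b w] at h2
    linarith

/-- Measure-theoretic entropy is bounded by the growth of partition sums over spanning sets. -/
lemma measEntropy_le_of_spanning_sum_le [CompactSpace X] {μ : Measure X} [IsProbabilityMeasure μ]
    {f : X → X} (hf : Continuous f) (hμ : MeasurePreserving f μ μ) {χ : X → ℝ}
    (hχ : Continuous χ)
    (h : ∀ᶠ ε in 𝓝[>] (0 : ℝ), ∃ C : ℝ, ∀ᶠ n : ℕ in atTop, ∃ F : Finset X,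
      IsSpanningSetOf f n ε univ F ∧ ∑ z ∈ F, Real.exp (birkhoff f χ n z) ≤ C) :
    measEntropy f μ ≤ ((-∫ x, χ x ∂μ : ℝ) : EReal) := by
  refine iSup_le fun k => iSup_le fun p => iSup_le fun hp => ?_
  refine EReal.le_of_forall_lt_iff_le.1 fun w hw => ?_
  have hw : -∫ x, χ x ∂μ < w := by exact_mod_cast hw
  obtain ⟨x₀⟩ : Nonempty X := nonempty_of_isProbabilityMeasure μ
  have hk : (0 : ℝ) < k := by exact_mod_cast (p x₀).pos
  set η := w + ∫ x, χ x ∂μ with hη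
  have hη0 : 0 < η := by linarith
  set δ := 1 - Real.exp (-(η / 4)) with hδ
  have hδ1 : δ < 1 := by have := Real.exp_pos (-(η / 4)); linarith
  have hδ0 : 0 < δ := by
    have : Real.exp (-(η / 4)) < 1 := by simp; linarith
    linarith
  have hlog : -Real.log (1 - δ) = η / 4 := by rw [hδ, _root_.sub_sub_cancel, Real.log_exp, neg_neg]
  set c₁ := -Real.log (δ / k) with hc₁
  obtain ⟨A, hA, hAρ, hcode⟩ := exists_approx_coding (μ := μ) hp
    (ρ := η / (4 * (|c₁| + 1))) (by positivity)
  have hA' : c₁ * μ.real Aᶜ ≤ η / 4 := by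
    have h1 : c₁ * μ.real Aᶜ ≤ (|c₁| + 1) * (η / (4 * (|c₁| + 1))) := by
      gcongr
      linarith [le_abs_self c₁]
    have h2 : (|c₁| + 1) * (η / (4 * (|c₁| + 1))) = η / 4 := by field_simp
    linarith
  obtain ⟨ε, ⟨C, hC⟩, ⟨y, hy⟩, hχε⟩ := (h.and (hcode.and
    (eventually_dist_le_imp_abs_sub_le hχ (ω := η / 4) (by positivity)))).exists
  refine liminf_le_of_le (h := fun b hb => ?_)
  obtain ⟨n, hb, ⟨F, hF, hFC⟩, hn, hn1⟩ := (hb.and (hC.and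
    ((eventually_ge_atTop ⌈Real.log C / (η / 4)⌉₊).and (eventually_ge_atTop 1)))).exists
  refine hb.trans (EReal.coe_le_coe_iff.2 ?_)
  have hn0 : (0 : ℝ) < n := by exact_mod_cast hn1
  have h1 := mapEntropy_itinerary_le hf hμ hχ hp hA hδ0 hδ1 hχε hy hF hFC
  rw [hlog, ← hc₁] at h1
  have h2 : Real.log C ≤ n * (η / 4) := by
    rw [← div_le_iff₀ (by positivity)]
    exact (Nat.le_ceil _).trans (by exact_mod_cast hn)
  rw [inv_mul_le_iff₀ hn0]
  refine h1.trans ?_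
  have h3 : n * (η / 4 - ∫ x, χ x ∂μ + (η / 4 + c₁ * μ.real Aᶜ)) ≤
      n * (w - η / 4) := by
    gcongr
    linarith
  linarith

/-- The variational inequality for the induced pressure. -/
lemma measEntropy_le_of_inducedPressure_lt [CompactSpace X] {μ : Measure X}
    [IsProbabilityMeasure μ] {f : X → X} (hf : Continuous f) (hμ : MeasurePreserving f μ μ)
    {φ ψ : X → ℝ} (hφ : Continuous φ) (hψ : Continuous ψ) (hpos : ∀ x, 0 < ψ x) {β : ℝ}
    (hβ : inducedPressure f ψ φ < β) :
    measEntropy f μ ≤ ((β * ∫ x, ψ x ∂μ - ∫ x, φ x ∂μ : ℝ) : EReal) := by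
  have hc : Continuous fun x => φ x - β * ψ x := hφ.sub (continuous_const.mul hψ)
  refine (measEntropy_le_of_spanning_sum_le hf hμ hc
    (eventually_exists_spanning_sum_le hψ hpos hβ)).trans_eq ?_
  rw [integral_sub (integrable_of_continuous hφ) ((integrable_of_continuous hψ).const_mul β),
    integral_const_mul, neg_sub]

lemma integral_pos_of_continuous [CompactSpace X] {μ : Measure X} [IsProbabilityMeasure μ]
    {ψ : X → ℝ} (hψ : Continuous ψ) (hpos : ∀ x, 0 < ψ x) : 0 < ∫ x, ψ x ∂μ := by
  obtain ⟨m, hm0, hm⟩ := exists_pos_le hψ hpos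
  refine hm0.trans_le ?_
  simpa using integral_mono (integrable_const (μ := μ) m) (integrable_of_continuous hψ) hm

end EntropyFacts

/-- For `h_top(f) < ∞` and continuous `φ, ψ` with `ψ > 0`:
(i) `t_{ψ,φ}(X,f)` is a compact convex set (in the weak* topology);
(ii) `M_{ψ,φ}(X,f) ⊆ t_{ψ,φ}(X,f) ⊆ M(X,f)`;
(iii) `μ ∈ t_{ψ,φ}(X,f)` iff `P_ψ(φ) − (∫φ dμ)/(∫ψ dμ) = inf_{h ∈ C(X,ℝ)}
(P_ψ(h) − (∫h dμ)/(∫ψ dμ))`. -/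
theorem tangentSet_properties
    {X : Type*} [MetricSpace X] [CompactSpace X] [Nonempty X]
    [MeasurableSpace X] [BorelSpace X]
    (f : X → X) (hf : Continuous f)
    (φ ψ : X → ℝ) (hφ : Continuous φ) (hψ : Continuous ψ) (hψpos : ∀ x, 0 < ψ x)
    (htop : topEntropy f < ⊤) :
    (IsCompact (tangentSet f ψ φ) ∧
      ∀ μ ∈ tangentSet f ψ φ, ∀ ν ∈ tangentSet f ψ φ, ∀ p : ℝ, 0 ≤ p → p ≤ 1 →
        ∃ κ ∈ tangentSet f ψ φ, (κ : Measure X) =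
          ENNReal.ofReal p • (μ : Measure X) + ENNReal.ofReal (1 - p) • (ν : Measure X)) ∧
    ((∀ μ : ProbabilityMeasure X,
        (μ : Measure X) ∈ equilibriumStates f ψ φ → μ ∈ tangentSet f ψ φ) ∧
      ∀ μ ∈ tangentSet f ψ φ, (μ : Measure X) ∈ invMeasures f) ∧
    (∀ μ : ProbabilityMeasure X, μ ∈ tangentSet f ψ φ ↔
      inducedPressure f ψ φ -
          (((∫ x, φ x ∂(μ : Measure X)) / (∫ x, ψ x ∂(μ : Measure X)) : ℝ) : EReal) =
        ⨅ h : C(X, ℝ),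
          (inducedPressure f ψ h -
            (((∫ x, h x ∂(μ : Measure X)) / (∫ x, ψ x ∂(μ : Measure X)) : ℝ) : EReal))) := by
  have hintegrable : ∀ (μ : ProbabilityMeasure X) {g : X → ℝ}, Continuous g →
      Integrable g (μ : Measure X) :=
    fun _ _ hg => integrable_of_continuous hg
  have hψint : ∀ μ : ProbabilityMeasure X, 0 < ∫ x, ψ x ∂(μ : Measure X) :=
    fun μ => integral_pos_of_continuous hψ hψpos
  set R : (X → ℝ) → ℝ := fun g => (inducedPressure f ψ g).toReal
  have hR : ∀ {g : X → ℝ}, Continuous g → inducedPressure f ψ g = (R g : EReal) := fun hg =>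
    (EReal.coe_toReal (inducedPressure_lt_top htop hg hψ hψpos).ne
      (bot_lt_inducedPressure hg hψ hψpos).ne').symm
  have hmem : ∀ μ : ProbabilityMeasure X, μ ∈ tangentSet f ψ φ ↔ ∀ g : X → ℝ, Continuous g →
      (∫ x, g x ∂(μ : Measure X)) / (∫ x, ψ x ∂(μ : Measure X)) ≤
        R (fun x => φ x + g x) - R φ := by
    intro μ
    refine forall₂_congr fun g hg => ?_
    rw [hR (show Continuous fun x => φ x + g x from hφ.add hg), hR hφ, ← EReal.coe_sub, EReal.coe_le_coe_iff]
  refine ⟨⟨IsClosed.isCompact ?_, ?_⟩, ⟨?_, ?_⟩, ?_⟩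
  · have : tangentSet f ψ φ = ⋂ (g : X → ℝ) (_ : Continuous g), {μ : ProbabilityMeasure X |
        (∫ x, g x ∂(μ : Measure X)) / (∫ x, ψ x ∂(μ : Measure X)) ≤
          R (fun x => φ x + g x) - R φ} := by
      ext μ; simp only [hmem, Set.mem_iInter, Set.mem_ofPred_eq]
    rw [this]
    have hcont : ∀ {g : X → ℝ}, Continuous g →
        Continuous fun μ : ProbabilityMeasure X => ∫ x, g x ∂(μ : Measure X) := fun hg =>
      ProbabilityMeasure.continuous_integral_boundedContinuousFunction
        (BoundedContinuousFunction.mkOfCompact ⟨_, hg⟩)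
    exact isClosed_iInter fun g => isClosed_iInter fun hg =>
      isClosed_le ((hcont hg).div (hcont hψ) fun μ => (hψint μ).ne') continuous_const
  · intro μ hμ ν hν p hp0 hp1
    have hκ : IsProbabilityMeasure
        (ENNReal.ofReal p • (μ : Measure X) + ENNReal.ofReal (1 - p) • (ν : Measure X)) :=
      ⟨by simp [← ENNReal.ofReal_add hp0 (sub_nonneg.2 hp1)]⟩
    set κ : ProbabilityMeasure X := ⟨_, hκ⟩
    have hκcoe : (κ : Measure X) =
      ENNReal.ofReal p • (μ : Measure X) + ENNReal.ofReal (1 - p) • (ν : Measure X) := rfl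
    refine ⟨κ, ?_, hκcoe⟩
    have hκint : ∀ {g : X → ℝ}, Continuous g →
        ∫ x, g x ∂(κ : Measure X) =
          p * ∫ x, g x ∂(μ : Measure X) + (1 - p) * ∫ x, g x ∂(ν : Measure X) := by
      intro g hg
      rw [hκcoe, integral_add_measure ((hintegrable μ hg).smul_measure ENNReal.ofReal_ne_top)
        ((hintegrable ν hg).smul_measure ENNReal.ofReal_ne_top), integral_smul_measure,
        integral_smul_measure, ENNReal.toReal_ofReal hp0,
        ENNReal.toReal_ofReal (sub_nonneg.2 hp1), smul_eq_mul, smul_eq_mul]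
    rw [hmem] at hμ hν ⊢
    intro g hg
    have h1 := hμ g hg
    have h2 := hν g hg
    rw [div_le_iff₀ (hψint _)] at h1 h2 ⊢
    rw [hκint hg, hκint hψ]
    have h4 := mul_le_mul_of_nonneg_left h1 hp0
    have h5 := mul_le_mul_of_nonneg_left h2 (sub_nonneg.2 hp1)
    linarith
  · rintro μ ⟨⟨-, hinv⟩, heq⟩
    have hμ : MeasurePreserving f (μ : Measure X) (μ : Measure X) :=
      ⟨hf.measurable, Measure.ext fun B hB => by rw [Measure.map_apply hf.measurable hB, hinv B hB]⟩
    rw [hmem]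
    intro g hg
    have hφg : Continuous fun x => φ x + g x := hφ.add hg
    refine le_of_forall_pos_le_add fun η hη => ?_
    have hlt : inducedPressure f ψ (fun x => φ x + g x) <
        ((R (fun x => φ x + g x) + η : ℝ) : EReal) := by
      rw [hR hφg]; exact_mod_cast lt_add_of_pos_right _ hη
    have hle := measEntropy_le_of_inducedPressure_lt hf hμ hφg hψ hψpos hlt
    rw [hR hφ] at heq
    have hpos' : (0 : EReal) < ((∫ x, ψ x ∂(μ : Measure X) : ℝ) : EReal) := by
      exact_mod_cast hψint μ
    have hge := (EReal.le_div_iff_mul_le hpos' (EReal.coe_ne_top _)).1 heq.le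
    have hge' := hge.trans (add_le_add_left hle _)
    rw [← EReal.coe_mul, ← EReal.coe_add, EReal.coe_le_coe_iff,
      integral_add (hintegrable μ hφ) (hintegrable μ hg)] at hge'
    rw [div_le_iff₀ (hψint μ)]
    linarith
  · intro μ hμ
    rw [hmem] at hμ
    have hle : ∀ {g : X → ℝ}, Continuous g →
        ∫ x, g (f x) ∂(μ : Measure X) ≤ ∫ x, g x ∂(μ : Measure X) := by
      intro g hg
      have hg' : Continuous fun x => g (f x) - g x := (hg.comp hf).sub hg
      have h1 := hμ _ hg'
      have h2 := inducedPressure_add_coboundary_le (f := f) (ψ := ψ) (φ := φ) hg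
      rw [hR (show Continuous fun x => φ x + (g (f x) - g x) from hφ.add hg'), hR hφ,
        EReal.coe_le_coe_iff] at h2
      rw [div_le_iff₀ (hψint μ),
        integral_sub (hintegrable μ (show Continuous fun x => g (f x) from hg.comp hf)) (hintegrable μ hg)] at h1
      have h3 := mul_nonpos_of_nonpos_of_nonneg (sub_nonpos.2 h2) (hψint μ).le
      linarith
    have hmap : (μ : Measure X).map f = μ := by
      have := Measure.isProbabilityMeasure_map (μ := (μ : Measure X)) hf.measurable.aemeasurable
      refine ext_of_forall_integral_eq_of_IsFiniteMeasure fun g => ?_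
      rw [integral_map hf.measurable.aemeasurable g.continuous.aestronglyMeasurable]
      refine le_antisymm (hle g.continuous) ?_
      have h := hle g.continuous.neg
      simp only [Pi.neg_apply, integral_neg] at h
      linarith
    exact ⟨inferInstance, fun B hB => by rw [← Measure.map_apply hf.measurable hB, hmap]⟩
  · intro μ
    rw [hmem, hR hφ, ← EReal.coe_sub]
    have hterm : ∀ h : C(X, ℝ), inducedPressure f ψ h -
        (((∫ x, h x ∂(μ : Measure X)) / (∫ x, ψ x ∂(μ : Measure X)) : ℝ) : EReal) =
        ((R h - (∫ x, h x ∂(μ : Measure X)) / (∫ x, ψ x ∂(μ : Measure X)) : ℝ) : EReal) :=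
      fun h => by rw [hR h.continuous, EReal.coe_sub]
    simp only [hterm]
    constructor
    · intro h
      refine le_antisymm (le_iInf fun k => EReal.coe_le_coe_iff.2 ?_) (iInf_le_of_le ⟨φ, hφ⟩ le_rfl)
      have h1 := h (fun x => k x - φ x) (k.continuous.sub hφ)
      simp only [add_sub_cancel] at h1
      rw [integral_sub (hintegrable μ k.continuous) (hintegrable μ hφ), sub_div] at h1
      change _ ≤ R k - _ at h1
      linarith
    · intro h g hg
      have h1 := h.le.trans (iInf_le _ (⟨fun x => φ x + g x, hφ.add hg⟩ : C(X, ℝ)))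
      rw [EReal.coe_le_coe_iff] at h1
      simp only [ContinuousMap.coe_mk] at h1
      rw [integral_add (hintegrable μ hφ) (hintegrable μ hg), add_div] at h1
      linarith
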